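/- There exists a constant d (depending only on the universal machine) such that for every nondeterministic communication protocol Π = (𝓡, t) over D = {0,1}^{n₁} × {0,1}^{n₂} and every (x,y) ∈ D: IC_Π(x,y) ≤ C(t_{x,y} ∣ Π) + log₂ ρ(t_{x,y}) + d·log₂ n + d, where n = max(n₁,n₂). -/

import Mathlib

/-- A machine maps a program and a condition string to at most one output string. -/
abbrev Machine := List Bool → List Bool →. List Bool

/-- Conditional Kolmogorov complexity relative to machine `U`. -/
noncomputable def KC (U : Machine) (x u : List Bool) : ℕ :=
  sInf { k | ∃ p : List Bool, p.length = k ∧ x ∈ U p u }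

/-- `U` is a universal machine. -/
def IsUniversal (U : Machine) : Prop :=
  Partrec₂ U ∧
    ∀ V : Machine, Partrec₂ V →
      ∃ c : ℕ, ∀ p u x, x ∈ V p u → ∃ q : List Bool, x ∈ U q u ∧ q.length ≤ p.length + c

/-- Self-delimiting encoding of a string. -/
def eBits (x : List Bool) : List Bool := (x.map fun b => [b, b]).flatten ++ [true, false]

/-- The fixed computable pairing of strings. -/
def ePair (x y : List Bool) : List Bool := eBits x ++ y

/-- Encoding of a list of strings. -/
def eList (l : List (List Bool)) : List Bool := (l.map eBits).flatten

/-- Conditional mutual information `I(x : y ∣ u)`. -/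
noncomputable def MI (U : Machine) (x y u : List Bool) : ℝ :=
  (KC U x u : ℝ) + KC U y u - KC U (ePair x y) u

/-- Conditional triple information `I(x : y : w ∣ u)`. -/
noncomputable def TI (U : Machine) (x y w u : List Bool) : ℝ :=
  (KC U x u : ℝ) + KC U y u + KC U w u - KC U (ePair x y) u - KC U (ePair x w) u
    - KC U (ePair y w) u + KC U (ePair x (ePair y w)) u

/-- A combinatorial rectangle, given by its list of rows and list of columns. -/
structure Rect where
  rows : List (List Bool)
  cols : List (List Bool)
deriving DecidableEq

/-- Canonical encoding of a rectangle. -/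
def encRect (R : Rect) : List Bool := ePair (eList R.rows) (eList R.cols)

/-- The list of all bit strings of length `n`. -/
def allBV : ℕ → List (List Bool)
  | 0 => [[]]
  | n + 1 => (allBV n).flatMap fun x => [false :: x, true :: x]

/-- A nondeterministic communication protocol over `{0,1}^{n₁} × {0,1}^{n₂}`:
a finite family of rectangles covering the domain together with a transcript
function selecting, for every cell of the domain, a rectangle containing it. -/
structure Protocol (n₁ n₂ : ℕ) where
  rects : List Rect
  trans : List Bool → List Bool → Rect
  rows_len : ∀ R ∈ rects, ∀ s ∈ R.rows, s.length = n₁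
  cols_len : ∀ R ∈ rects, ∀ s ∈ R.cols, s.length = n₂
  trans_mem : ∀ x y : List Bool, x.length = n₁ → y.length = n₂ → trans x y ∈ rects
  trans_row : ∀ x y : List Bool, x.length = n₁ → y.length = n₂ → x ∈ (trans x y).rows
  trans_col : ∀ x y : List Bool, x.length = n₁ → y.length = n₂ → y ∈ (trans x y).cols

/-- The thickness of a cell: the number of rectangles of the protocol containing it. -/
def cellThick {n₁ n₂ : ℕ} (P : Protocol n₁ n₂) (x y : List Bool) : ℕ :=
  P.rects.countP fun R => decide (x ∈ R.rows ∧ y ∈ R.cols)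

/-- The thickness of a rectangle: the maximal thickness of a cell of the rectangle. -/
def rectThick {n₁ n₂ : ℕ} (P : Protocol n₁ n₂) (R : Rect) : ℕ :=
  (R.rows.flatMap fun x => R.cols.map fun y => cellThick P x y).foldr max 0

/-- Canonical encoding of a protocol: the list of its rectangles followed by
the graph of the transcript function on the domain. -/
def encProt {n₁ n₂ : ℕ} (P : Protocol n₁ n₂) : List Bool :=
  ePair (eList (P.rects.map encRect))
    (eList ((allBV n₁).flatMap fun x => (allBV n₂).map fun y => encRect (P.trans x y)))

/-- The internal information cost of a protocol on input `(x, y)`: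
`I(x : t_{x,y} ∣ y, Π) + I(y : t_{x,y} ∣ x, Π)`. -/
noncomputable def ICost {n₁ n₂ : ℕ} (U : Machine) (P : Protocol n₁ n₂) (x y : List Bool) : ℝ :=
  MI U x (encRect (P.trans x y)) (ePair y (encProt P))
    + MI U y (encRect (P.trans x y)) (ePair x (encProt P))

/-- A predicate is `Σ₁` when it is the projection of a primitive recursive relation. -/
def SigmaOne {α : Type*} [Primcodable α] (p : α → Prop) : Prop :=
  ∃ q : α → ℕ → Prop, PrimrecRel q ∧ ∀ a, p a ↔ ∃ n, q a n

namespace SigmaOne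

variable {α β γ : Type*} [Primcodable α] [Primcodable β] [Primcodable γ]

theorem of_primrec {p : α → Prop} (hp : PrimrecPred p) : SigmaOne p :=
  ⟨fun a _ => p a, hp.comp Primrec.fst, fun a => by simp⟩

theorem of_iff {p p' : α → Prop} (hp : SigmaOne p) (h : ∀ a, p' a ↔ p a) : SigmaOne p' := by
  obtain rfl : p' = p := funext fun a => propext (h a)
  exact hp

theorem comp {p : β → Prop} (hp : SigmaOne p) {f : α → β} (hf : Primrec f) :
    SigmaOne fun a => p (f a) := by
  obtain ⟨q, hq, h⟩ := hp
  exact ⟨fun a n => q (f a) n, hq.comp (hf.comp Primrec.fst) Primrec.snd, fun a => h (f a)⟩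

theorem exist {p : α × β → Prop} (hp : SigmaOne p) : SigmaOne fun a => ∃ b, p (a, b) := by
  obtain ⟨q, hq, h⟩ := hp
  have hrel : PrimrecRel fun (b : β) (x : α × ℕ) => q (x.1, b) x.2.unpair.2 :=
    hq.comp ((Primrec.fst.comp Primrec.snd).pair Primrec.fst)
      (Primrec.snd.comp (Primrec.unpair.comp (Primrec.snd.comp Primrec.snd)))
  have hlist : Primrec fun x : α × ℕ => (Encodable.decode (α := β) x.2.unpair.1).toList :=
    Primrec.optionToList.comp (Primrec.decode.comp
      (Primrec.fst.comp (Primrec.unpair.comp Primrec.snd)))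
  refine ⟨fun a n => ∃ b ∈ (Encodable.decode (α := β) n.unpair.1).toList,
    q (a, b) n.unpair.2, hrel.exists_mem_list.comp hlist Primrec.id, fun a => ?_⟩
  constructor
  · rintro ⟨b, hb⟩
    obtain ⟨n, hn⟩ := (h _).1 hb
    exact ⟨Nat.pair (Encodable.encode b) n, b, by simp, by simpa using hn⟩
  · rintro ⟨n, b, -, hn⟩
    exact ⟨b, (h _).2 ⟨_, hn⟩⟩

theorem and {p p' : α → Prop} (hp : SigmaOne p) (hp' : SigmaOne p') :
    SigmaOne fun a => p a ∧ p' a := by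
  obtain ⟨q, hq, h⟩ := hp
  obtain ⟨q', hq', h'⟩ := hp'
  refine ⟨fun a n => q a n.unpair.1 ∧ q' a n.unpair.2,
    (hq.comp Primrec.fst (Primrec.fst.comp (Primrec.unpair.comp Primrec.snd))).and
      (hq'.comp Primrec.fst (Primrec.snd.comp (Primrec.unpair.comp Primrec.snd))), fun a => ?_⟩
  simp only [h, h']
  constructor
  · rintro ⟨⟨m, hm⟩, n, hn⟩
    exact ⟨Nat.pair m n, by simpa using hm, by simpa using hn⟩
  · rintro ⟨n, h1, h2⟩
    exact ⟨⟨_, h1⟩, _, h2⟩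

theorem exists_unique_witness {p : α → Prop} (hp : SigmaOne p) :
    ∃ q : α → ℕ → Prop, PrimrecRel q ∧ (∀ a, p a ↔ ∃ n, q a n) ∧
      ∀ a m n, q a m → q a n → m = n := by
  classical
  obtain ⟨q, hq, h⟩ := hp
  have hlt : PrimrecRel fun (n : ℕ) (a : α) => ∀ m < n, ¬ q a m :=
    (PrimrecRel.forall_mem_list (R := fun m a => ¬ q a m) hq.swap.not).comp
      (Primrec.list_range.comp Primrec.fst) Primrec.snd |>.of_eq fun x => by simp [List.mem_range]
  refine ⟨fun a n => q a n ∧ ∀ m < n, ¬ q a m, hq.and hlt.swap, fun a => ?_, ?_⟩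
  · rw [h]
    exact ⟨fun hn => ⟨Nat.find hn, Nat.find_spec hn, fun m hm => Nat.find_min hn hm⟩,
      fun ⟨n, hn, _⟩ => ⟨n, hn⟩⟩
  · rintro a m n ⟨hm, hm'⟩ ⟨hn, hn'⟩
    rcases lt_trichotomy m n with hlt | rfl | hlt
    · exact (hn' m hlt hm).elim
    · rfl
    · exact (hm' n hlt hn).elim

/-- A `Σ₁` relation can be enumerated without repetition by a primitive recursive process. -/
theorem exists_stages {W : α × β → Prop} (hW : SigmaOne W) :
    ∃ H : α → β → ℕ → Prop, PrimrecPred (fun x : (α × β) × ℕ => H x.1.1 x.1.2 x.2) ∧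
      PrimrecRel (fun a m => ∃ b, H a b m) ∧ (∀ a b, W (a, b) ↔ ∃ m, H a b m) ∧
      (∀ a b m n, H a b m → H a b n → m = n) ∧ ∀ a b c m, H a b m → H a c m → b = c := by
  obtain ⟨q, hq, h, huniq⟩ := hW.exists_unique_witness
  have hH : PrimrecPred (fun x : (α × β) × ℕ =>
      x.2.unpair.1 = Encodable.encode x.1.2 ∧ q x.1 x.2.unpair.2) :=
    (Primrec.eq.comp (Primrec.fst.comp (Primrec.unpair.comp Primrec.snd))
      (Primrec.encode.comp (Primrec.snd.comp Primrec.fst))).and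
    (hq.comp Primrec.fst (Primrec.snd.comp (Primrec.unpair.comp Primrec.snd)))
  refine ⟨fun a b m => m.unpair.1 = Encodable.encode b ∧ q (a, b) m.unpair.2, hH, ?_, ?_, ?_, ?_⟩
  · have hrel : PrimrecRel fun (b : β) (x : α × ℕ) =>
        x.2.unpair.1 = Encodable.encode b ∧ q (x.1, b) x.2.unpair.2 :=
      hH.comp (f := fun y : β × α × ℕ => ((y.2.1, y.1), y.2.2))
        (((Primrec.fst.comp Primrec.snd).pair Primrec.fst).pair (Primrec.snd.comp Primrec.snd))
    have hlist : Primrec fun x : α × ℕ => (Encodable.decode (α := β) x.2.unpair.1).toList :=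
      Primrec.optionToList.comp (Primrec.decode.comp
        (Primrec.fst.comp (Primrec.unpair.comp Primrec.snd)))
    refine (hrel.exists_mem_list.comp hlist Primrec.id).of_eq fun x => ?_
    constructor
    · rintro ⟨b, -, hb⟩
      exact ⟨b, hb⟩
    · rintro ⟨b, hb⟩
      exact ⟨b, by simp [hb.1], hb⟩
  · intro a b
    rw [h]
    exact ⟨fun ⟨n, hn⟩ => ⟨Nat.pair (Encodable.encode b) n, by simp, by simpa using hn⟩,
      fun ⟨m, _, hm⟩ => ⟨_, hm⟩⟩
  · rintro a b m n ⟨hm, hm'⟩ ⟨hn, hn'⟩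
    rw [← Nat.pair_unpair m, ← Nat.pair_unpair n, hm, hn, huniq _ _ _ hm' hn']
  · rintro a b c m ⟨hm, -⟩ ⟨hn, -⟩
    exact Encodable.encode_injective (hm.symm.trans hn)

theorem primrec_count {h : α → ℕ → Prop} [∀ a, DecidablePred (h a)] (hh : PrimrecRel h) :
    Primrec fun x : α × ℕ => Nat.count (h x.1) x.2 := by
  have hstep : Primrec₂ fun (x : α × ℕ) (y : ℕ × ℕ) => y.2 + if h x.1 y.1 then 1 else 0 :=
    Primrec.nat_add.comp (Primrec.snd.comp Primrec.snd)
      (Primrec.ite (hh.comp (Primrec.fst.comp Primrec.fst) (Primrec.fst.comp Primrec.snd))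
        (Primrec.const 1) (Primrec.const 0))
  refine (Primrec.nat_rec' Primrec.snd (Primrec.const 0) hstep).of_eq fun x => ?_
  obtain ⟨a, n⟩ := x
  induction n with
  | zero => simp
  | succ n ih => simp only [Nat.count_succ, ← ih]

theorem exists_finset_card_eq_count {β : Type*} {H : β → ℕ → Prop} [DecidablePred fun m => ∃ b, H b m]
    (huniq : ∀ b m n, H b m → H b n → m = n) (M : ℕ) :
    ∃ F : Finset β, F.card = Nat.count (fun m => ∃ b, H b m) M ∧ ∀ b ∈ F, ∃ m < M, H b m := by
  classical
  induction M with
  | zero => exact ⟨∅, by simp⟩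
  | succ M ih =>
    obtain ⟨F, hF, hF'⟩ := ih
    by_cases hM : ∃ b, H b M
    · obtain ⟨b, hb⟩ := hM
      have hbF : b ∉ F := fun hbF => by
        obtain ⟨m, hm, hbm⟩ := hF' b hbF
        exact hm.ne (huniq b m M hbm hb)
      refine ⟨insert b F, ?_, fun c hc => ?_⟩
      · rw [Finset.card_insert_of_notMem hbF, hF, Nat.count_succ, if_pos ⟨b, hb⟩]
      · rcases Finset.mem_insert.1 hc with rfl | hc
        · exact ⟨M, M.lt_succ_self, hb⟩
        · obtain ⟨m, hm, hcm⟩ := hF' c hc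
          exact ⟨m, hm.trans M.lt_succ_self, hcm⟩
    · refine ⟨F, by rw [hF, Nat.count_succ, if_neg hM, add_zero], fun c hc => ?_⟩
      obtain ⟨m, hm, hcm⟩ := hF' c hc
      exact ⟨m, hm.trans M.lt_succ_self, hcm⟩

/-- Elements of the sections of a `Σ₁` relation are effectively indexed by numbers below the
cardinality of the section. -/
theorem exists_index {W : α × β → Prop} (hW : SigmaOne W) :
    ∃ I : α → ℕ → β → Prop, SigmaOne (fun x : (α × ℕ) × β => I x.1.1 x.1.2 x.2) ∧
      (∀ a i b c, I a i b → I a i c → b = c) ∧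
      ∀ a b N, W (a, b) → (∀ F : Finset β, (∀ c ∈ F, W (a, c)) → F.card ≤ N) →
        ∃ i < N, I a i b := by
  classical
  obtain ⟨H, hH, hhit, hWH, huniq, hfun⟩ := hW.exists_stages
  refine ⟨fun a i b => ∃ m, H a b m ∧ Nat.count (fun m => ∃ b, H a b m) m = i, ?_, ?_, ?_⟩
  · refine exist (p := fun x : ((α × ℕ) × β) × ℕ => H x.1.1.1 x.1.2 x.2 ∧
      Nat.count (fun m => ∃ b, H x.1.1.1 b m) x.2 = x.1.1.2) (of_primrec ?_)
    refine (hH.comp (f := fun x : ((α × ℕ) × β) × ℕ => ((x.1.1.1, x.1.2), x.2)) ?_).and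
      (Primrec.eq.comp ((primrec_count hhit).comp
        (g := fun x : ((α × ℕ) × β) × ℕ => (x.1.1.1, x.2)) ?_) ?_)
    · exact ((Primrec.fst.comp (Primrec.fst.comp Primrec.fst)).pair
        (Primrec.snd.comp Primrec.fst)).pair Primrec.snd
    · exact (Primrec.fst.comp (Primrec.fst.comp Primrec.fst)).pair Primrec.snd
    · exact Primrec.snd.comp (Primrec.fst.comp Primrec.fst)
  · rintro a i b c ⟨m, hm, hmi⟩ ⟨n, hn, hni⟩
    obtain rfl := Nat.count_injective (p := fun m => ∃ b, H a b m) ⟨b, hm⟩ ⟨c, hn⟩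
      (hmi.trans hni.symm)
    exact hfun a b c m hm hn
  · intro a b N hb hN
    obtain ⟨m, hm⟩ := (hWH a b).1 hb
    refine ⟨_, ?_, m, hm, rfl⟩
    obtain ⟨F, hF, hF'⟩ := exists_finset_card_eq_count (H := H a) (huniq a) (m + 1)
    have := hN F fun c hc => (hWH a c).2 ((hF' c hc).imp fun _ h => h.2)
    rw [hF, Nat.count_succ, if_pos ⟨b, hm⟩] at this
    omega

theorem exists_finset_card {W : α × β → Prop} (hW : SigmaOne W) :
    SigmaOne fun x : α × ℕ => ∃ F : Finset β, F.card = x.2 ∧ ∀ b ∈ F, W (x.1, b) := by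
  classical
  obtain ⟨H, hH, hhit, hWH, huniq, hfun⟩ := hW.exists_stages
  refine of_iff (exist (p := fun x : (α × ℕ) × ℕ =>
    x.1.2 ≤ Nat.count (fun m => ∃ b, H x.1.1 b m) x.2) (of_primrec (Primrec.nat_le.comp
      (Primrec.snd.comp Primrec.fst) ((primrec_count hhit).comp
        (g := fun x : (α × ℕ) × ℕ => (x.1.1, x.2))
        ((Primrec.fst.comp Primrec.fst).pair Primrec.snd))))) ?_
  rintro ⟨a, N⟩
  constructor
  · rintro ⟨F, rfl, hF⟩
    have hex : ∀ b, ∃ m, b ∈ F → H a b m := fun b => by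
      by_cases hb : b ∈ F
      · exact ((hWH a b).1 (hF b hb)).imp fun _ h _ => h
      · exact ⟨0, fun h => (hb h).elim⟩
    choose g hg using hex
    refine ⟨F.sup g + 1, ?_⟩
    rw [Nat.count_eq_card_filter_range]
    refine Finset.card_le_card_of_injOn g (fun b hb => ?_) fun b hb c hc hbc => ?_
    · simp only [Finset.coe_filter, Finset.mem_range, Set.mem_ofPred_eq]
      exact ⟨Nat.lt_succ_of_le (Finset.le_sup hb), b, hg b hb⟩
    · exact hfun a b c _ (hg b hb) (hbc ▸ hg c hc)
  · rintro ⟨M, hM⟩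
    obtain ⟨F, hF, hF'⟩ := exists_finset_card_eq_count (H := H a) (huniq a) M
    obtain ⟨F₀, hF₀, hcard⟩ := Finset.exists_subset_card_eq (hM.trans hF.ge)
    exact ⟨F₀, hcard, fun b hb => (hWH a b).2 ((hF' b (hF₀ hb)).imp fun _ h => h.2)⟩

theorem of_partrec {f : α →. β} (hf : Partrec f) : SigmaOne fun x : α × β => x.2 ∈ f x.1 := by
  obtain ⟨c, hc⟩ := Nat.Partrec.Code.exists_code.1 hf
  refine ⟨fun x n => Nat.Partrec.Code.evaln n c (Encodable.encode x.1) =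
    some (Encodable.encode x.2), ?_, fun x => ?_⟩
  · exact Primrec.eq.comp (Nat.Partrec.Code.primrec_evaln.comp
      ((Primrec.snd.pair (Primrec.const c)).pair
        (Primrec.encode.comp (Primrec.fst.comp Primrec.fst))))
      (Primrec.option_some.comp (Primrec.encode.comp (Primrec.snd.comp Primrec.fst)))
  · have := Nat.Partrec.Code.evaln_complete (c := c) (n := Encodable.encode x.1)
      (x := Encodable.encode x.2)
    simp only [Option.mem_def] at this
    rw [← this, hc]
    simp

/-- A functional `Σ₁` relation is the graph of a partial recursive function. -/
theorem exists_partrec {R : α × β → Prop} (hR : SigmaOne R)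
    (hf : ∀ a b c, R (a, b) → R (a, c) → b = c) :
    ∃ f : α →. β, Partrec f ∧ ∀ a b, b ∈ f a ↔ R (a, b) := by
  classical
  obtain ⟨q, hq, h⟩ := hR
  let g : α → ℕ → Option β := fun a n =>
    (Encodable.decode (α := β) n.unpair.1).bind fun b =>
      if q (a, b) n.unpair.2 then some b else none
  have hg : Primrec₂ g := by
    refine Primrec.option_bind (Primrec.decode.comp
      (Primrec.fst.comp (Primrec.unpair.comp Primrec.snd))) ?_
    refine Primrec.ite (hq.comp ((Primrec.fst.comp Primrec.fst).pair Primrec.snd)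
      (Primrec.snd.comp (Primrec.unpair.comp (Primrec.snd.comp Primrec.fst))))
      (Primrec.option_some.comp Primrec.snd) (Primrec.const none)
  have hgR : ∀ a n b, b ∈ g a n → R (a, b) := by
    intro a n b hb
    simp only [g, Option.mem_def, Option.bind_eq_some_iff] at hb
    obtain ⟨b', -, hb'⟩ := hb
    split_ifs at hb' with hq'
    obtain rfl := Option.some.inj hb'
    exact (h _).2 ⟨_, hq'⟩
  refine ⟨fun a => Nat.rfindOpt (g a), Partrec.rfindOpt hg.to_comp, fun a b => ⟨fun hb => ?_,
    fun hb => ?_⟩⟩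
  · obtain ⟨n, hn⟩ := Nat.rfindOpt_spec hb
    exact hgR a n b hn
  · obtain ⟨n, hn⟩ := (h _).1 hb
    have hdom : (Nat.rfindOpt (g a)).Dom := Nat.rfindOpt_dom.2
      ⟨Nat.pair (Encodable.encode b) n, b, by simp [g, hn]⟩
    obtain ⟨m, hm⟩ := Nat.rfindOpt_spec (Part.get_mem hdom)
    rw [hf a b _ hb (hgR a m _ hm)]
    exact Part.get_mem hdom

end SigmaOne

section Encoding

theorem eBits_nil : eBits [] = [true, false] := rfl

theorem eBits_cons (b : Bool) (a : List Bool) : eBits (b :: a) = b :: b :: eBits a := by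
  simp [eBits]

theorem length_eBits (a : List Bool) : (eBits a).length = 2 * a.length + 2 := by
  induction a with
  | nil => rfl
  | cons b a ih => simp only [eBits_cons, List.length_cons, ih]; ring

theorem ePair_inj {a b a' b' : List Bool} : ePair a b = ePair a' b' ↔ a = a' ∧ b = b' := by
  refine ⟨fun h => ?_, by rintro ⟨rfl, rfl⟩; rfl⟩
  induction a generalizing a' with
  | nil =>
    cases a' with
    | nil => simpa [ePair, eBits_nil] using h
    | cons c a' => cases c <;> simp [ePair, eBits_nil, eBits_cons] at h
  | cons c a ih =>
    cases a' with
    | nil => cases c <;> simp [ePair, eBits_nil, eBits_cons] at h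
    | cons c' a' =>
      simp only [ePair, eBits_cons, List.cons_append, List.cons.injEq] at h
      obtain ⟨rfl, rfl⟩ := ih h.2.2
      exact ⟨by rw [h.1], rfl⟩

theorem eList_cons (a : List Bool) (l : List (List Bool)) :
    eList (a :: l) = ePair a (eList l) := by
  simp [eList, ePair]

theorem eList_injective : Function.Injective eList := by
  intro l
  induction l with
  | nil =>
    intro l' h
    cases l' with
    | nil => rfl
    | cons a l' => simp [eBits, eList] at h
  | cons a l ih =>
    intro l' h
    cases l' with
    | nil => simp [eBits, eList] at h
    | cons a' l' =>
      rw [eList_cons, eList_cons, ePair_inj] at h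
      rw [h.1, ih h.2]

theorem encRect_injective : Function.Injective encRect := by
  rintro ⟨r, c⟩ ⟨r', c'⟩ h
  obtain ⟨hr, hc⟩ := ePair_inj.1 h
  rw [Rect.mk.injEq]
  exact ⟨eList_injective hr, eList_injective hc⟩

theorem primrec_eBits : Primrec eBits := by
  refine Primrec.list_append.comp (Primrec.list_flatten.comp (Primrec.list_map Primrec.id ?_))
    (Primrec.const _)
  exact Primrec.list_cons.comp Primrec.snd
    (Primrec.list_cons.comp Primrec.snd (Primrec.const []))

theorem primrec_ePair : Primrec₂ ePair :=
  Primrec.list_append.comp (primrec_eBits.comp Primrec.fst) Primrec.snd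

theorem primrec_eList : Primrec eList :=
  Primrec.list_flatten.comp (Primrec.list_map Primrec.id (primrec_eBits.comp Primrec.snd))

theorem primrec_encRect : Primrec fun R : List (List Bool) × List (List Bool) =>
    encRect ⟨R.1, R.2⟩ :=
  primrec_ePair.comp (primrec_eList.comp Primrec.fst) (primrec_eList.comp Primrec.snd)

/-- The number whose little-endian binary expansion is the given string. -/
def bitsValue (l : List Bool) : ℕ :=
  l.foldr (fun b n => cond b 1 0 + 2 * n) 0

theorem bitsValue_bits (n : ℕ) : bitsValue n.bits = n := by
  conv_rhs => rw [← Nat.ofDigits_digits 2 n, Nat.digits_two_eq_bits, Nat.ofDigits_eq_foldr,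
    List.foldr_map]
  simp only [bitsValue]
  congr 1

theorem primrec_bitsValue : Primrec bitsValue := by
  refine Primrec.list_foldr (h := fun (_ : List Bool) (y : Bool × ℕ) => cond y.1 1 0 + 2 * y.2)
    Primrec.id (Primrec.const 0) ?_
  exact Primrec.nat_add.comp (Primrec.cond (Primrec.fst.comp Primrec.snd)
    (Primrec.const 1) (Primrec.const 0))
    (Primrec.nat_mul.comp (Primrec.const 2) (Primrec.snd.comp Primrec.snd))

theorem length_allBV (n : ℕ) : (allBV n).length = 2 ^ n := by
  induction n with
  | zero => rfl
  | succ n ih => simp [allBV, List.length_flatMap, ih, pow_succ]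

theorem mem_allBV {n : ℕ} {x : List Bool} : x ∈ allBV n ↔ x.length = n := by
  induction n generalizing x with
  | zero => simp [allBV]
  | succ n ih =>
    simp only [allBV, List.mem_flatMap, ih, List.mem_cons, List.not_mem_nil, or_false]
    constructor
    · rintro ⟨a, rfl, rfl | rfl⟩ <;> simp
    · intro h
      cases x with
      | nil => simp at h
      | cons b x => exact ⟨x, by simpa using h, by cases b <;> simp⟩

theorem size_pair_le {a b s : ℕ} (ha : Nat.size a ≤ s) (hb : Nat.size b ≤ s) :
    Nat.size (Nat.pair a b) ≤ 2 * s := by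
  rw [Nat.size_le] at *
  calc Nat.pair a b < (max a b + 1) ^ 2 := Nat.pair_lt_max_add_one_sq a b
    _ ≤ (2 ^ s) ^ 2 := Nat.pow_le_pow_left (Nat.succ_le_of_lt (max_lt ha hb)) 2
    _ = 2 ^ (2 * s) := by rw [← pow_mul, mul_comm]

end Encoding

section Universal

/-- The string `z` is produced from the condition `u` by a program of length `k`. -/
def HasProgram (U : Machine) (k : ℕ) (u z : List Bool) : Prop :=
  ∃ p : List Bool, p.length = k ∧ z ∈ U p u

theorem HasProgram.exists_finset (U : Machine) (k : ℕ) (u : List Bool) :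
    ∃ A : Finset (List Bool), A.card ≤ 2 ^ k ∧ ∀ z, z ∈ A ↔ HasProgram U k u z := by
  classical
  refine ⟨((allBV k).filterMap fun p => (U p u).toOption).toFinset, ?_, fun z => ?_⟩
  · exact (List.toFinset_card_le _).trans
      ((List.length_filterMap_le _ _).trans (length_allBV k).le)
  · simp only [List.mem_toFinset, List.mem_filterMap, mem_allBV, HasProgram]
    exact exists_congr fun p => and_congr_right fun _ => Part.mem_toOption

theorem HasProgram.card_le {U : Machine} {k : ℕ} {u : List Bool} {F : Finset (List Bool)}
    (hF : ∀ z ∈ F, HasProgram U k u z) : F.card ≤ 2 ^ k := by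
  obtain ⟨A, hA, hmem⟩ := HasProgram.exists_finset U k u
  exact (Finset.card_le_card fun z hz => (hmem z).2 (hF z hz)).trans hA

variable {U : Machine}

theorem HasProgram.sigmaOne (hU : IsUniversal U) :
    SigmaOne fun x : (ℕ × List Bool) × List Bool => HasProgram U x.1.1 x.1.2 x.2 := by
  refine SigmaOne.exist (p := fun x : ((ℕ × List Bool) × List Bool) × List Bool =>
    x.2.length = x.1.1.1 ∧ x.1.2 ∈ U x.2 x.1.1.2) (SigmaOne.and (SigmaOne.of_primrec ?_) ?_)
  · exact Primrec.eq.comp (Primrec.list_length.comp Primrec.snd)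
      (Primrec.fst.comp (Primrec.fst.comp Primrec.fst))
  · exact (SigmaOne.of_partrec hU.1).comp
      (f := fun x : ((ℕ × List Bool) × List Bool) × List Bool => ((x.2, x.1.1.2), x.1.2))
      ((Primrec.snd.pair (Primrec.snd.comp (Primrec.fst.comp Primrec.fst))).pair
        (Primrec.snd.comp Primrec.fst))

theorem HasProgram.KC_le {k : ℕ} {u z : List Bool} (h : HasProgram U k u z) : KC U z u ≤ k :=
  Nat.sInf_le h

theorem KC_le_of_functional (hU : IsUniversal U)
    {R : (List Bool × List Bool) × List Bool → Prop} (hR : SigmaOne R)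
    (hf : ∀ a b c, R (a, b) → R (a, c) → b = c) :
    ∃ c : ℕ, ∀ p u z, R ((p, u), z) → KC U z u ≤ p.length + c := by
  obtain ⟨f, hf, hfR⟩ := hR.exists_partrec hf
  obtain ⟨c, hc⟩ := hU.2 (fun p u => f (p, u)) hf
  refine ⟨c, fun p u z hz => ?_⟩
  obtain ⟨q, hq, hlen⟩ := hc p u z ((hfR _ _).2 hz)
  exact (HasProgram.KC_le ⟨q, rfl, hq⟩).trans hlen

theorem hasProgram_KC (hU : IsUniversal U) (z u : List Bool) :
    HasProgram U (KC U z u) u z := by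
  obtain ⟨c, hc⟩ := hU.2 (fun p _ => Part.some p) Computable.fst
  obtain ⟨q, hq, -⟩ := hc z u z (Part.mem_some z)
  exact Nat.sInf_mem (s := {k | HasProgram U k u z}) ⟨q.length, q, rfl, hq⟩

theorem exists_KC_le_length (hU : IsUniversal U) :
    ∃ c : ℕ, ∀ z u, KC U z u ≤ z.length + c := by
  obtain ⟨c, hc⟩ := hU.2 (fun p _ => Part.some p) Computable.fst
  refine ⟨c, fun z u => ?_⟩
  obtain ⟨q, hq, hlen⟩ := hc z u z (Part.mem_some z)
  exact (HasProgram.KC_le ⟨q, rfl, hq⟩).trans hlen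

/-- An element of an enumerable set with at most `2 ^ s` elements has complexity at most `s`,
up to the cost of describing the parameter `w` of the enumeration. -/
theorem KC_le_of_card (hU : IsUniversal U) {W : (ℕ × List Bool) × List Bool → Prop}
    (hW : SigmaOne W) :
    ∃ c : ℕ, ∀ w u z s, W ((w, u), z) →
      (∀ F : Finset (List Bool), (∀ b ∈ F, W ((w, u), b)) → F.card ≤ 2 ^ s) →
      KC U z u ≤ s + 2 * Nat.size w + c := by
  obtain ⟨I, hI, hfun, hidx⟩ := hW.exists_index
  have hR : SigmaOne fun x : (List Bool × List Bool) × List Bool =>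
      ∃ y : List Bool × List Bool, x.1.1 = ePair y.1 y.2 ∧
        I (bitsValue y.1, x.1.2) (bitsValue y.2) x.2 := by
    refine SigmaOne.exist (p := fun v : ((List Bool × List Bool) × List Bool) ×
      (List Bool × List Bool) => v.1.1.1 = ePair v.2.1 v.2.2 ∧
        I (bitsValue v.2.1, v.1.1.2) (bitsValue v.2.2) v.1.2)
      (SigmaOne.and (SigmaOne.of_primrec ?_) ?_)
    · exact Primrec.eq.comp (Primrec.fst.comp (Primrec.fst.comp Primrec.fst))
        (primrec_ePair.comp (Primrec.fst.comp Primrec.snd) (Primrec.snd.comp Primrec.snd))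
    · exact hI.comp (f := fun v : ((List Bool × List Bool) × List Bool) ×
        (List Bool × List Bool) => (((bitsValue v.2.1, v.1.1.2), bitsValue v.2.2), v.1.2))
        ((((primrec_bitsValue.comp (Primrec.fst.comp Primrec.snd)).pair
          (Primrec.snd.comp (Primrec.fst.comp Primrec.fst))).pair
          (primrec_bitsValue.comp (Primrec.snd.comp Primrec.snd))).pair
          (Primrec.snd.comp Primrec.fst))
  obtain ⟨c, hc⟩ := KC_le_of_functional hU hR (by
    rintro ⟨p, u⟩ z z' ⟨y, hp, hy⟩ ⟨y', hp', hy'⟩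
    have := ePair_inj.1 (hp.symm.trans hp')
    rw [this.1, this.2] at hy
    exact hfun _ _ _ _ hy hy')
  refine ⟨c + 2, fun w u z s hz hcard => ?_⟩
  obtain ⟨i, hi, hIi⟩ := hidx _ _ _ hz hcard
  have := hc (ePair w.bits i.bits) u z ⟨(w.bits, i.bits), rfl, by simpa [bitsValue_bits] using hIi⟩
  have hs : Nat.size i ≤ s := Nat.size_le.2 hi
  rw [ePair, List.length_append, length_eBits, Nat.size_eq_bits_len,
    Nat.size_eq_bits_len] at this
  omega

end Universal

section Complexity

variable {U : Machine}

theorem exists_KC_le_KC_ePair (hU : IsUniversal U) :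
    ∃ c : ℕ, ∀ x t u, KC U x u ≤ KC U (ePair x t) u + c := by
  have hR : SigmaOne fun x : (List Bool × List Bool) × List Bool =>
      ∃ t : List Bool, ePair x.2 t ∈ U x.1.1 x.1.2 :=
    SigmaOne.exist ((SigmaOne.of_partrec hU.1).comp
      (f := fun v : ((List Bool × List Bool) × List Bool) × List Bool => (v.1.1, ePair v.1.2 v.2))
      ((Primrec.fst.comp Primrec.fst).pair
        (primrec_ePair.comp (Primrec.snd.comp Primrec.fst) Primrec.snd)))
  obtain ⟨c, hc⟩ := KC_le_of_functional hU hR (by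
    rintro ⟨p, u⟩ z z' ⟨t, ht⟩ ⟨t', ht'⟩
    exact (ePair_inj.1 (Part.mem_unique ht ht')).1)
  refine ⟨c, fun x t u => ?_⟩
  obtain ⟨p, hp, hpx⟩ := hasProgram_KC hU (ePair x t) u
  rw [← hp]
  exact hc p u x ⟨t, hpx⟩

theorem exists_KC_ePair_le_KC (hU : IsUniversal U) :
    ∃ c : ℕ, ∀ t x u, KC U t (ePair x u) ≤ KC U t u + c := by
  have hR : SigmaOne fun x : (List Bool × List Bool) × List Bool =>
      ∃ y : List Bool × List Bool, x.1.2 = ePair y.1 y.2 ∧ x.2 ∈ U x.1.1 y.2 := by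
    refine SigmaOne.exist (p := fun v : ((List Bool × List Bool) × List Bool) ×
      (List Bool × List Bool) => v.1.1.2 = ePair v.2.1 v.2.2 ∧ v.1.2 ∈ U v.1.1.1 v.2.2)
      (SigmaOne.and (SigmaOne.of_primrec ?_) ?_)
    · exact Primrec.eq.comp (Primrec.snd.comp (Primrec.fst.comp Primrec.fst))
        (primrec_ePair.comp (Primrec.fst.comp Primrec.snd) (Primrec.snd.comp Primrec.snd))
    · exact (SigmaOne.of_partrec hU.1).comp
        (f := fun v : ((List Bool × List Bool) × List Bool) × (List Bool × List Bool) =>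
          ((v.1.1.1, v.2.2), v.1.2))
        (((Primrec.fst.comp (Primrec.fst.comp Primrec.fst)).pair
          (Primrec.snd.comp Primrec.snd)).pair (Primrec.snd.comp Primrec.fst))
  obtain ⟨c, hc⟩ := KC_le_of_functional hU hR (by
    rintro ⟨p, u⟩ z z' ⟨y, hy, hz⟩ ⟨y', hy', hz'⟩
    have := (ePair_inj.1 (hy.symm.trans hy')).2
    rw [this] at hz
    exact Part.mem_unique hz hz')
  refine ⟨c, fun t x u => ?_⟩
  obtain ⟨p, hp, hpx⟩ := hasProgram_KC hU t u
  rw [← hp]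
  exact hc p _ t ⟨(x, u), rfl, hpx⟩

/-- A member of a list is determined by the list and an index. -/
theorem exists_KC_le_of_mem (hU : IsUniversal U) :
    ∃ c : ℕ, ∀ (a : List Bool) (l : List (List Bool)) (s : ℕ) (z : List Bool),
      z ∈ l → l.length ≤ 2 ^ s → KC U z (ePair a (eList l)) ≤ s + c := by
  classical
  have hmem : PrimrecRel fun (l : List (List Bool)) (z : List Bool) => ∃ a ∈ l, a = z :=
    PrimrecRel.exists_mem_list Primrec.eq
  have hW : SigmaOne fun x : (ℕ × List Bool) × List Bool =>
      ∃ y : List Bool × List (List Bool), x.1.2 = ePair y.1 (eList y.2) ∧ ∃ a ∈ y.2, a = x.2 := by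
    refine SigmaOne.exist (p := fun v : ((ℕ × List Bool) × List Bool) ×
      (List Bool × List (List Bool)) => v.1.1.2 = ePair v.2.1 (eList v.2.2) ∧
        ∃ a ∈ v.2.2, a = v.1.2) (SigmaOne.of_primrec (PrimrecPred.and ?_ ?_))
    · exact Primrec.eq.comp (Primrec.snd.comp (Primrec.fst.comp Primrec.fst))
        (primrec_ePair.comp (Primrec.fst.comp Primrec.snd)
          (primrec_eList.comp (Primrec.snd.comp Primrec.snd)))
    · exact hmem.comp (Primrec.snd.comp Primrec.snd) (Primrec.snd.comp Primrec.fst)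
  obtain ⟨c, hc⟩ := KC_le_of_card hU hW
  refine ⟨c, fun a l s z hz hl => ?_⟩
  simpa using hc 0 (ePair a (eList l)) z s ⟨(a, l), rfl, z, hz, rfl⟩ fun F hF => by
    refine le_trans (Finset.card_le_card fun b hb => ?_) ((List.toFinset_card_le l).trans hl)
    obtain ⟨⟨a', l'⟩, hy, b', hb', rfl⟩ := hF b hb
    rw [List.mem_toFinset, eList_injective (ePair_inj.1 hy).2]
    exact hb'

theorem exists_log_card {β : Type*} {S : β → Prop} {b : β} (hb : S b) {k : ℕ}
    (hk : ∀ F : Finset β, (∀ c ∈ F, S c) → F.card ≤ 2 ^ k) :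
    ∃ h ≤ k, (∃ F : Finset β, F.card = 2 ^ h ∧ ∀ c ∈ F, S c) ∧
      ∀ F : Finset β, (∀ c ∈ F, S c) → F.card ≤ 2 ^ (h + 1) := by
  classical
  have h0 : ∃ F : Finset β, F.card = 2 ^ 0 ∧ ∀ c ∈ F, S c := ⟨{b}, by simp, by simpa using hb⟩
  refine ⟨Nat.findGreatest (fun h => ∃ F : Finset β, F.card = 2 ^ h ∧ ∀ c ∈ F, S c) k,
    Nat.findGreatest_le k, Nat.findGreatest_spec
      (P := fun h => ∃ F : Finset β, F.card = 2 ^ h ∧ ∀ c ∈ F, S c) (Nat.zero_le k) h0,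
    fun F hF => ?_⟩
  by_contra! hlt
  obtain ⟨F₀, hF₀, hcard⟩ := Finset.exists_subset_card_eq hlt.le
  have hF₀S : ∀ c ∈ F₀, S c := fun c hc => hF c (hF₀ hc)
  have hle := (Nat.pow_le_pow_iff_right (by norm_num : 1 < 2)).1 (hcard ▸ hk F₀ hF₀S)
  have := Nat.le_findGreatest (P := fun h => ∃ F : Finset β, F.card = 2 ^ h ∧ ∀ c ∈ F, S c)
    hle ⟨F₀, hcard, hF₀S⟩
  omega

theorem primrec_two_pow : Primrec fun n : ℕ => 2 ^ n := by
  refine (Primrec.nat_rec₁ (f := fun _ m => 2 * m) 1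
    (Primrec.nat_mul.comp (Primrec.const 2) Primrec.snd)).of_eq fun n => ?_
  induction n with
  | zero => rfl
  | succ n ih => rw [pow_succ, ← ih, mul_comm]

/-- The nontrivial direction of the chain rule for conditional complexity. -/
theorem exists_KC_add_KC_le (hU : IsUniversal U) :
    ∃ c : ℕ, ∀ t x u S, Nat.size (KC U t u) ≤ S → Nat.size (KC U x (ePair t u)) ≤ S →
      KC U t (ePair x u) + KC U x u ≤ KC U t u + KC U x (ePair t u) + 12 * S + c := by
  classical
  let D : ((ℕ × List Bool) × List Bool) × List Bool → Prop := fun v =>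
    HasProgram U v.1.1.1.unpair.1 v.1.1.2 v.2 ∧
      HasProgram U v.1.1.1.unpair.2 (ePair v.2 v.1.1.2) v.1.2
  have hD : SigmaOne D := by
    have h1 : Primrec fun v : ((ℕ × List Bool) × List Bool) × List Bool => v.1.1.1.unpair :=
      Primrec.unpair.comp (Primrec.fst.comp (Primrec.fst.comp Primrec.fst))
    have h2 : Primrec fun v : ((ℕ × List Bool) × List Bool) × List Bool => v.1.1.2 :=
      Primrec.snd.comp (Primrec.fst.comp Primrec.fst)
    exact SigmaOne.and
      ((HasProgram.sigmaOne hU).comp (f := fun v : ((ℕ × List Bool) × List Bool) × List Bool =>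
        ((v.1.1.1.unpair.1, v.1.1.2), v.2)) (((Primrec.fst.comp h1).pair h2).pair Primrec.snd))
      ((HasProgram.sigmaOne hU).comp (f := fun v : ((ℕ × List Bool) × List Bool) × List Bool =>
        ((v.1.1.1.unpair.2, ePair v.2 v.1.1.2), v.1.2))
        (((Primrec.snd.comp h1).pair (primrec_ePair.comp Primrec.snd h2)).pair
          (Primrec.snd.comp Primrec.fst)))
  have hW₁ : SigmaOne fun v : (ℕ × List Bool) × List Bool =>
      ∃ y : List Bool × List Bool, v.1.2 = ePair y.1 y.2 ∧ D (((v.1.1, y.2), y.1), v.2) := by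
    refine SigmaOne.exist (p := fun v : ((ℕ × List Bool) × List Bool) ×
      (List Bool × List Bool) => v.1.1.2 = ePair v.2.1 v.2.2 ∧
        D (((v.1.1.1, v.2.2), v.2.1), v.1.2)) (SigmaOne.and (SigmaOne.of_primrec ?_) ?_)
    · exact Primrec.eq.comp (Primrec.snd.comp (Primrec.fst.comp Primrec.fst))
        (primrec_ePair.comp (Primrec.fst.comp Primrec.snd) (Primrec.snd.comp Primrec.snd))
    · exact hD.comp (f := fun v : ((ℕ × List Bool) × List Bool) × (List Bool × List Bool) =>
        (((v.1.1.1, v.2.2), v.2.1), v.1.2))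
        ((((Primrec.fst.comp (Primrec.fst.comp Primrec.fst)).pair
          (Primrec.snd.comp Primrec.snd)).pair (Primrec.fst.comp Primrec.snd)).pair
          (Primrec.snd.comp Primrec.fst))
  have hW₂ : SigmaOne fun v : (ℕ × List Bool) × List Bool =>
      ∃ F : Finset (List Bool), F.card = 2 ^ v.1.1.unpair.2 ∧
        ∀ t ∈ F, D (((v.1.1.unpair.1, v.1.2), v.2), t) := by
    have h1 : Primrec fun v : (ℕ × List Bool) × List Bool => v.1.1.unpair :=
      Primrec.unpair.comp (Primrec.fst.comp Primrec.fst)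
    exact hD.exists_finset_card.comp (f := fun v : (ℕ × List Bool) × List Bool =>
        (((v.1.1.unpair.1, v.1.2), v.2), 2 ^ v.1.1.unpair.2))
      ((((Primrec.fst.comp h1).pair (Primrec.snd.comp Primrec.fst)).pair Primrec.snd).pair
        (primrec_two_pow.comp (Primrec.snd.comp h1)))
  obtain ⟨c₁, hc₁⟩ := KC_le_of_card hU hW₁
  obtain ⟨c₂, hc₂⟩ := KC_le_of_card hU hW₂
  refine ⟨c₁ + c₂ + 1, fun t x u S hk hi => ?_⟩
  set k := KC U t u with hk_def
  set i := KC U x (ePair t u) with hi_def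
  have hDt : D (((Nat.pair k i, u), x), t) := by
    simpa [D] using And.intro (hasProgram_KC hU t u) (hasProgram_KC hU x (ePair t u))
  obtain ⟨h, hhk, hlow, hhigh⟩ := exists_log_card (S := fun t => D (((Nat.pair k i, u), x), t))
    hDt (k := k) fun F hF => HasProgram.card_le (U := U) (u := u) fun z hz => by
      simpa using (hF z hz).1
  have hsize : Nat.size (Nat.pair k i) ≤ 2 * S := size_pair_le hk hi
  have hsize' : Nat.size (Nat.pair (Nat.pair k i) h) ≤ 2 * (2 * S) :=
    size_pair_le hsize ((Nat.size_le_size hhk).trans (hk.trans (by omega)))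
  have ht := hc₁ (Nat.pair k i) (ePair x u) t (h + 1) ⟨(x, u), rfl, hDt⟩ fun F hF =>
    hhigh F fun c hc => by
      obtain ⟨⟨x', u'⟩, hy, hD'⟩ := hF c hc
      obtain ⟨rfl, rfl⟩ := ePair_inj.1 hy
      exact hD'
  have hx := hc₂ (Nat.pair (Nat.pair k i) h) u x (k + i - h) (by simpa using hlow) fun F hF => by
    have hF' : ∀ z ∈ F, ∃ G : Finset (List Bool), G.card = 2 ^ h ∧
        ∀ t ∈ G, HasProgram U k u t ∧ HasProgram U i (ePair t u) z := by simpa [D] using hF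
    obtain ⟨A, hA, hAmem⟩ := HasProgram.exists_finset U k u
    choose B hB hBmem using fun t => HasProgram.exists_finset U i (ePair t u)
    have key : F.card * 2 ^ h ≤ (A.sigma B).card * 1 := by
      refine Finset.card_mul_le_card_mul (fun z (y : (_ : List Bool) × List Bool) => y.2 = z)
        (fun z hz => ?_) fun y hy => ?_
      · obtain ⟨G, hG, hGmem⟩ := hF' z hz
        rw [← hG]
        refine Finset.card_le_card_of_injOn (fun t => ⟨t, z⟩) (fun t ht => ?_) fun t _ t' _ h => ?_
        · simpa [Finset.bipartiteAbove, hAmem, hBmem] using hGmem t ht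
        · exact congrArg Sigma.fst h
      · refine Finset.card_le_one.2 fun a ha b hb => ?_
        simp only [Finset.bipartiteBelow, Finset.mem_filter] at ha hb
        exact ha.2.symm.trans hb.2
    have hsig : (A.sigma B).card ≤ 2 ^ k * 2 ^ i := by
      rw [Finset.card_sigma]
      calc ∑ t ∈ A, (B t).card ≤ A.card * 2 ^ i :=
            Finset.sum_le_card_nsmul _ _ _ fun t _ => hB t
        _ ≤ 2 ^ k * 2 ^ i := Nat.mul_le_mul_right _ hA
    refine Nat.le_of_mul_le_mul_right (c := 2 ^ h) ?_ (by positivity)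
    rw [← pow_add, Nat.sub_add_cancel (by omega), pow_add]
    omega
  omega

end Complexity

section Rectangles

variable {U : Machine}

/-- The rows and columns of a rectangle, as an element of a `Primcodable` type. -/
abbrev RectData := List (List Bool) × List (List Bool)

/-- The canonical encoding of the rectangle with the given rows and columns. -/
def encData (R : RectData) : List Bool := encRect ⟨R.1, R.2⟩

theorem encData_injective : Function.Injective encData := by
  rintro ⟨r, c⟩ ⟨r', c'⟩ h
  have := encRect_injective h
  rw [Rect.mk.injEq] at this
  exact Prod.ext this.1 this.2

theorem primrec_encData : Primrec encData := primrec_encRect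

theorem primrecRel_mem_list {α : Type*} [Primcodable α] :
    PrimrecRel fun (l : List α) (z : α) => z ∈ l :=
  (PrimrecRel.exists_mem_list Primrec.eq).of_eq fun x => by simp

/-- The strings of complexity `p` among the rows, or columns, of a rectangle. -/
def InSide (U : Machine) (side : RectData → List (List Bool))
    (v : ((RectData × ℕ) × List Bool) × List Bool) : Prop :=
  v.2 ∈ side v.1.1.1 ∧ HasProgram U v.1.1.2 v.1.2 v.2

theorem InSide.sigmaOne (hU : IsUniversal U) {side : RectData → List (List Bool)}
    (hside : Primrec side) : SigmaOne (InSide U side) := by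
  refine SigmaOne.and (SigmaOne.of_primrec ?_) ?_
  · exact primrecRel_mem_list.comp
      (hside.comp (Primrec.fst.comp (Primrec.fst.comp Primrec.fst))) Primrec.snd
  · exact (HasProgram.sigmaOne hU).comp
      (f := fun v : ((RectData × ℕ) × List Bool) × List Bool => ((v.1.1.2, v.1.2), v.2))
      (((Primrec.snd.comp (Primrec.fst.comp Primrec.fst)).pair
        (Primrec.snd.comp Primrec.fst)).pair Primrec.snd)

theorem exists_KC_le_of_inSide (hU : IsUniversal U) {side : RectData → List (List Bool)}
    (hside : Primrec side) :
    ∃ c : ℕ, ∀ R p u x s, InSide U side (((R, p), u), x) →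
      (∀ F : Finset (List Bool), (∀ z ∈ F, InSide U side (((R, p), u), z)) → F.card ≤ 2 ^ s) →
      KC U x (ePair (encData R) u) ≤ s + 2 * Nat.size p + c := by
  have hW : SigmaOne fun v : (ℕ × List Bool) × List Bool => ∃ y : RectData × List Bool,
      v.1.2 = ePair (encData y.1) y.2 ∧ InSide U side (((y.1, v.1.1), y.2), v.2) := by
    refine SigmaOne.exist (p := fun v : ((ℕ × List Bool) × List Bool) × (RectData × List Bool) =>
      v.1.1.2 = ePair (encData v.2.1) v.2.2 ∧
        InSide U side (((v.2.1, v.1.1.1), v.2.2), v.1.2))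
      (SigmaOne.and (SigmaOne.of_primrec ?_) ?_)
    · exact Primrec.eq.comp (Primrec.snd.comp (Primrec.fst.comp Primrec.fst))
        (primrec_ePair.comp (primrec_encData.comp (Primrec.fst.comp Primrec.snd))
          (Primrec.snd.comp Primrec.snd))
    · exact (InSide.sigmaOne hU hside).comp
        (f := fun v : ((ℕ × List Bool) × List Bool) × (RectData × List Bool) =>
          (((v.2.1, v.1.1.1), v.2.2), v.1.2))
        ((((Primrec.fst.comp Primrec.snd).pair
          (Primrec.fst.comp (Primrec.fst.comp Primrec.fst))).pair
          (Primrec.snd.comp Primrec.snd)).pair (Primrec.snd.comp Primrec.fst))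
  obtain ⟨c, hc⟩ := KC_le_of_card hU hW
  refine ⟨c, fun R p u x s hx hs => hc p _ x s ⟨(R, u), rfl, hx⟩ fun F hF => hs F fun z hz => ?_⟩
  obtain ⟨⟨R', u'⟩, hy, hz'⟩ := hF z hz
  obtain ⟨hR, rfl⟩ := ePair_inj.1 hy
  obtain rfl := encData_injective hR
  exact hz'

/-- Every cell of `R` lies in at most `N` rectangles of the list `Rs`. -/
def ThickLE (R : RectData) (Rs : List RectData) (N : ℕ) : Prop :=
  ∀ x ∈ R.1, ∀ y ∈ R.2, (Rs.filter fun R' => decide (x ∈ R'.1 ∧ y ∈ R'.2)).length ≤ N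

theorem ThickLE.primrecPred :
    PrimrecPred fun v : (RectData × List RectData) × ℕ => ThickLE v.1.1 v.1.2 v.2 := by
  have h1 : PrimrecRel fun (R' : RectData) (c : List Bool × List Bool) => c.1 ∈ R'.1 ∧ c.2 ∈ R'.2 :=
    (primrecRel_mem_list.comp (Primrec.fst.comp Primrec.fst)
      (Primrec.fst.comp Primrec.snd)).and
    (primrecRel_mem_list.comp (Primrec.snd.comp Primrec.fst) (Primrec.snd.comp Primrec.snd))
  have h2 : PrimrecRel fun (y : List Bool) (v : List Bool × ((RectData × List RectData) × ℕ)) =>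
      (v.2.1.2.filter fun R' => decide (v.1 ∈ R'.1 ∧ y ∈ R'.2)).length ≤ v.2.2 := by
    refine Primrec.nat_le.comp (Primrec.list_length.comp ?_)
      (Primrec.snd.comp (Primrec.snd.comp Primrec.snd))
    exact h1.listFilter.comp
      (Primrec.snd.comp (Primrec.fst.comp (Primrec.snd.comp Primrec.snd)))
      ((Primrec.fst.comp Primrec.snd).pair Primrec.fst)
  have h3 : PrimrecRel fun (x : List Bool) (v : (RectData × List RectData) × ℕ) =>
      ∀ y ∈ v.1.1.2, (v.1.2.filter fun R' => decide (x ∈ R'.1 ∧ y ∈ R'.2)).length ≤ v.2 :=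
    h2.forall_mem_list.comp
      (f := fun w : List Bool × ((RectData × List RectData) × ℕ) => w.2.1.1.2)
      (Primrec.snd.comp (Primrec.fst.comp (Primrec.fst.comp Primrec.snd))) Primrec.id
  exact h3.forall_mem_list.comp (f := fun v : (RectData × List RectData) × ℕ => v.1.1.1)
    (Primrec.fst.comp (Primrec.fst.comp Primrec.fst)) Primrec.id

/-- A rectangle of bounded thickness having many simple rows and columns is itself simple. -/
theorem exists_KC_encData_le (hU : IsUniversal U) :
    ∃ c : ℕ, ∀ (R : RectData) (Rs : List RectData) (rest : List Bool) (p q e f l S : ℕ),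
      R ∈ Rs → ThickLE R Rs (2 ^ l) → Nat.size p ≤ S → Nat.size q ≤ S → Nat.size l ≤ S →
      e ≤ p → f ≤ q →
      (∃ F : Finset (List Bool), F.card = 2 ^ e ∧
        ∀ x ∈ F, InSide U Prod.fst (((R, p), ePair (eList (Rs.map encData)) rest), x)) →
      (∃ F : Finset (List Bool), F.card = 2 ^ f ∧
        ∀ y ∈ F, InSide U Prod.snd (((R, q), ePair (eList (Rs.map encData)) rest), y)) →
      KC U (encData R) (ePair (eList (Rs.map encData)) rest) + e + f ≤ p + q + l + 16 * S + c := by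
  classical
  let C : ((ℕ × List Bool) × List Bool) × ((RectData × List RectData) × List Bool) → Prop :=
    fun v => (v.1.1.2 = ePair (eList (v.2.1.2.map encData)) v.2.2 ∧ v.2.1.1 ∈ v.2.1.2 ∧
      v.1.2 = encData v.2.1.1 ∧ ThickLE v.2.1.1 v.2.1.2 (2 ^ v.1.1.1.unpair.1)) ∧
      (∃ F : Finset (List Bool), F.card = 2 ^ v.1.1.1.unpair.2.unpair.1.unpair.2 ∧
        ∀ x ∈ F, InSide U Prod.fst
          (((v.2.1.1, v.1.1.1.unpair.2.unpair.1.unpair.1), v.1.1.2), x)) ∧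
      (∃ F : Finset (List Bool), F.card = 2 ^ v.1.1.1.unpair.2.unpair.2.unpair.2 ∧
        ∀ x ∈ F, InSide U Prod.snd
          (((v.2.1.1, v.1.1.1.unpair.2.unpair.2.unpair.1), v.1.1.2), x))
  have hC : SigmaOne C := by
    have hu : Primrec fun v : ((ℕ × List Bool) × List Bool) ×
        ((RectData × List RectData) × List Bool) => v.1.1.2 :=
      Primrec.snd.comp (Primrec.fst.comp Primrec.fst)
    have hw : Primrec fun v : ((ℕ × List Bool) × List Bool) ×
        ((RectData × List RectData) × List Bool) => v.1.1.1.unpair :=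
      Primrec.unpair.comp (Primrec.fst.comp (Primrec.fst.comp Primrec.fst))
    have hw₁ := Primrec.unpair.comp (Primrec.fst.comp (Primrec.unpair.comp (Primrec.snd.comp hw)))
    have hw₂ := Primrec.unpair.comp (Primrec.snd.comp (Primrec.unpair.comp (Primrec.snd.comp hw)))
    have hR : Primrec fun v : ((ℕ × List Bool) × List Bool) ×
        ((RectData × List RectData) × List Bool) => v.2.1.1 :=
      Primrec.fst.comp (Primrec.fst.comp Primrec.snd)
    have hRs : Primrec fun v : ((ℕ × List Bool) × List Bool) ×
        ((RectData × List RectData) × List Bool) => v.2.1.2 :=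
      Primrec.snd.comp (Primrec.fst.comp Primrec.snd)
    refine SigmaOne.and (SigmaOne.of_primrec (PrimrecPred.and ?_ (PrimrecPred.and ?_
      (PrimrecPred.and ?_ ?_)))) (SigmaOne.and ?_ ?_)
    · exact Primrec.eq.comp hu (primrec_ePair.comp (primrec_eList.comp
        (Primrec.list_map hRs (primrec_encData.comp Primrec.snd)))
        (Primrec.snd.comp Primrec.snd))
    · exact primrecRel_mem_list.comp hRs hR
    · exact Primrec.eq.comp (Primrec.snd.comp Primrec.fst) (primrec_encData.comp hR)
    · exact ThickLE.primrecPred.comp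
        ((hR.pair hRs).pair (primrec_two_pow.comp (Primrec.fst.comp hw)))
    · exact (InSide.sigmaOne hU Primrec.fst).exists_finset_card.comp
        (((hR.pair (Primrec.fst.comp hw₁)).pair hu).pair
          (primrec_two_pow.comp (Primrec.snd.comp hw₁)))
    · exact (InSide.sigmaOne hU Primrec.snd).exists_finset_card.comp
        (((hR.pair (Primrec.fst.comp hw₂)).pair hu).pair
          (primrec_two_pow.comp (Primrec.snd.comp hw₂)))
  obtain ⟨c, hc⟩ := KC_le_of_card hU hC.exist
  refine ⟨c, fun R Rs rest p q e f l S hR hthick hp hq hl hep hfq hF hG => ?_⟩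
  set u := ePair (eList (Rs.map encData)) rest with hu
  have hsize : Nat.size (Nat.pair l (Nat.pair (Nat.pair p e) (Nat.pair q f))) ≤
      2 * (2 * (2 * S)) :=
    size_pair_le (by omega) (size_pair_le
      (size_pair_le hp ((Nat.size_le_size hep).trans hp))
      (size_pair_le hq ((Nat.size_le_size hfq).trans hq)))
  have := hc (Nat.pair l (Nat.pair (Nat.pair p e) (Nat.pair q f))) u (encData R)
    (p + q + l - (e + f)) ⟨((R, Rs), rest), by simpa [C, hu] using ⟨⟨hR, hthick⟩, hF, hG⟩⟩
    fun E hE => by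
      have hE' : ∀ z ∈ E, ∃ R ∈ Rs, z = encData R ∧ ThickLE R Rs (2 ^ l) ∧
          (∃ F : Finset (List Bool), F.card = 2 ^ e ∧
            ∀ x ∈ F, InSide U Prod.fst (((R, p), u), x)) ∧
          ∃ F : Finset (List Bool), F.card = 2 ^ f ∧
            ∀ x ∈ F, InSide U Prod.snd (((R, q), u), x) := by
        intro z hz
        obtain ⟨⟨⟨R', Rs'⟩, rest'⟩, ⟨hy, hmem, hzR, hth⟩, hF', hG'⟩ := hE z hz
        have hRs : Rs' = Rs := encData_injective.list_map
          (eList_injective (ePair_inj.1 (hu.symm.trans hy)).1).symm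
        subst hRs
        simp only [Nat.unpair_pair] at hth hF' hG'
        exact ⟨R', hmem, hzR, hth, hF', hG'⟩
      obtain ⟨A, hA, hAmem⟩ := HasProgram.exists_finset U p u
      obtain ⟨B, hB, hBmem⟩ := HasProgram.exists_finset U q u
      have key : E.card * (2 ^ e * 2 ^ f) ≤ (A ×ˢ B).card * 2 ^ l := by
        refine Finset.card_mul_le_card_mul (fun z (v : List Bool × List Bool) =>
          ∃ R ∈ Rs, z = encData R ∧ ThickLE R Rs (2 ^ l) ∧ v.1 ∈ R.1 ∧ v.2 ∈ R.2)
          (fun z hz => ?_) fun v hv => ?_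
        · obtain ⟨R', hmem, hzR, hth, ⟨F, hF, hFmem⟩, G, hG, hGmem⟩ := hE' z hz
          rw [← hF, ← hG, ← Finset.card_product]
          refine Finset.card_le_card fun v hv => ?_
          obtain ⟨h1, h2⟩ := Finset.mem_product.1 hv
          simp only [Finset.bipartiteAbove, Finset.mem_filter, Finset.mem_product, hAmem, hBmem]
          exact ⟨⟨(hFmem _ h1).2, (hGmem _ h2).2⟩, R', hmem, hzR, hth, (hFmem _ h1).1,
            (hGmem _ h2).1⟩
        · rcases Finset.eq_empty_or_nonempty (E.bipartiteBelow
            (fun z (v : List Bool × List Bool) =>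
              ∃ R ∈ Rs, z = encData R ∧ ThickLE R Rs (2 ^ l) ∧ v.1 ∈ R.1 ∧ v.2 ∈ R.2) v)
            with h | ⟨z, hz⟩
          · rw [h]
            exact Nat.zero_le _
          · obtain ⟨-, R', -, -, hth, h1, h2⟩ := Finset.mem_filter.1 hz
            refine le_trans ?_ (hth v.1 h1 v.2 h2)
            refine le_trans (Finset.card_le_card (t := ((Rs.filter fun R' =>
              decide (v.1 ∈ R'.1 ∧ v.2 ∈ R'.2)).map encData).toFinset) fun z' hz' => ?_)
              ((List.toFinset_card_le _).trans (List.length_map _).le)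
            obtain ⟨-, R'', hmem, rfl, -, h1', h2'⟩ := Finset.mem_filter.1 hz'
            exact List.mem_toFinset.2 (List.mem_map_of_mem
              (List.mem_filter.2 ⟨hmem, by simpa using ⟨h1', h2'⟩⟩))
      refine Nat.le_of_mul_le_mul_right (c := 2 ^ (e + f)) ?_ (by positivity)
      rw [← pow_add 2 (p + q + l - (e + f)), Nat.sub_add_cancel (by omega), pow_add 2 e]
      refine key.trans ?_
      rw [Finset.card_product, pow_add, pow_add]
      exact Nat.mul_le_mul_right _ (Nat.mul_le_mul hA hB)
  omega

end Rectangles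

section InformationCost

variable {U : Machine}

theorem size_le_of_le_two_mul_add {a n c : ℕ} (h : a ≤ 2 * n + c) :
    Nat.size a ≤ Nat.size n + 1 + c := by
  have h1 := Nat.lt_size_self n
  have h2 : c < 2 ^ c := Nat.lt_two_pow_self
  refine Nat.size_le.2 ?_
  rw [pow_add, pow_succ]
  nlinarith

theorem natSize_le_logb_add_one (n : ℕ) : (Nat.size n : ℝ) ≤ Real.logb 2 n + 1 := by
  rcases Nat.eq_zero_or_pos n with rfl | hn
  · simp
  · have h : Nat.size n ≤ Nat.log 2 n + 1 :=
      Nat.size_le.2 (Nat.lt_pow_succ_log_self one_lt_two n)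
    have h' := Real.natLog_le_logb n 2
    have h'' : (Nat.size n : ℝ) ≤ Nat.log 2 n + 1 := by exact_mod_cast h
    push_cast at h'
    linarith

/-- The transcript is cheap to describe given one input, unless it is thick. -/
theorem exists_KC_encData_add_KC_encData_le (hU : IsUniversal U) (C : ℕ) :
    ∃ K : ℕ, ∀ (R : RectData) (Rs : List RectData) (rest x y : List Bool) (n l : ℕ),
      R ∈ Rs → x ∈ R.1 → y ∈ R.2 → ThickLE R Rs (2 ^ l) → x.length ≤ n → y.length ≤ n →
      l ≤ 2 * n → KC U (encData R) (ePair (eList (Rs.map encData)) rest) ≤ 2 * n + C →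
      KC U (encData R) (ePair x (ePair (eList (Rs.map encData)) rest)) +
        KC U (encData R) (ePair y (ePair (eList (Rs.map encData)) rest)) ≤
      KC U (encData R) (ePair (eList (Rs.map encData)) rest) + l + K * Nat.size n + K := by
  obtain ⟨c₁, h₁⟩ := exists_KC_le_length hU
  obtain ⟨c₂, h₂⟩ := exists_KC_add_KC_le hU
  obtain ⟨c₃, h₃⟩ := exists_KC_le_of_inSide hU (side := Prod.fst) Primrec.fst
  obtain ⟨c₄, h₄⟩ := exists_KC_le_of_inSide hU (side := Prod.snd) Primrec.snd
  obtain ⟨c₅, h₅⟩ := exists_KC_encData_le hU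
  refine ⟨44 * (1 + (C + c₁)) + 2 * c₂ + c₃ + c₄ + c₅ + 2,
    fun R Rs rest x y n l hR hx hy hthick hxn hyn hl hk => ?_⟩
  set u := ePair (eList (Rs.map encData)) rest
  have hS : ∀ {a : ℕ}, a ≤ 2 * n + (C + c₁) → Nat.size a ≤ Nat.size n + 1 + (C + c₁) :=
    size_le_of_le_two_mul_add
  have hxs : InSide U Prod.fst (((R, KC U x u), u), x) := ⟨hx, hasProgram_KC hU x u⟩
  have hys : InSide U Prod.snd (((R, KC U y u), u), y) := ⟨hy, hasProgram_KC hU y u⟩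
  obtain ⟨e, he, hF, hFmax⟩ := exists_log_card
    (S := fun z => InSide U Prod.fst (((R, KC U x u), u), z)) (k := KC U x u) hxs
    fun F hF => HasProgram.card_le fun z hz => (hF z hz).2
  obtain ⟨f, hf, hG, hGmax⟩ := exists_log_card
    (S := fun z => InSide U Prod.snd (((R, KC U y u), u), z)) (k := KC U y u) hys
    fun F hF => HasProgram.card_le fun z hz => (hF z hz).2
  have hxp := h₁ x u
  have hyp := h₁ y u
  have hxt := h₁ x (ePair (encData R) u)
  have hyt := h₁ y (ePair (encData R) u)
  have hsx := hS (a := KC U x u) (by omega)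
  have hsy := hS (a := KC U y u) (by omega)
  have hst := hS (a := KC U (encData R) u) (by omega)
  have a₁ := h₂ (encData R) x u _ hst (hS (by omega))
  have a₂ := h₂ (encData R) y u _ hst (hS (by omega))
  have b₁ := h₃ R _ u x _ hxs hFmax
  have b₂ := h₄ R _ u y _ hys hGmax
  have b₃ := h₅ R Rs rest _ _ e f l _ hR hthick hsx hsy (hS (by omega)) he hf hF hG
  change KC U (encData R) u + e + f ≤ _ at b₃
  have hK : 44 * Nat.size n ≤
      (44 * (1 + (C + c₁)) + 2 * c₂ + c₃ + c₄ + c₅ + 2) * Nat.size n :=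
    Nat.mul_le_mul_right _ (by omega)
  omega

variable {n₁ n₂ : ℕ} (P : Protocol n₁ n₂)

theorem le_foldr_max {l : List ℕ} {a : ℕ} (h : a ∈ l) : a ≤ l.foldr max 0 := by
  induction l with
  | nil => simp at h
  | cons b l ih =>
    rcases List.mem_cons.1 h with rfl | h
    · exact le_max_left _ _
    · exact (ih h).trans (le_max_right _ _)

theorem cellThick_le_rectThick {R : Rect} {x y : List Bool} (hx : x ∈ R.rows) (hy : y ∈ R.cols) :
    cellThick P x y ≤ rectThick P R :=
  le_foldr_max (List.mem_flatMap.2 ⟨x, hx, List.mem_map_of_mem hy⟩)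

theorem thickLE_of_rectThick_le {R : Rect} {N : ℕ} (h : rectThick P R ≤ N) :
    ThickLE (R.rows, R.cols) (P.rects.map fun R => (R.rows, R.cols)) N := by
  intro x hx y hy
  refine le_trans (le_of_eq ?_) ((cellThick_le_rectThick P hx hy).trans h)
  rw [← List.countP_eq_length_filter, List.countP_map]
  rfl

theorem map_encRect_rects :
    P.rects.map encRect = (P.rects.map fun R => (R.rows, R.cols)).map encData := by
  rw [List.map_map]
  rfl

theorem exists_KC_trans_le (hU : IsUniversal U) :
    ∃ c : ℕ, ∀ n₁ n₂ : ℕ, ∀ P : Protocol n₁ n₂, ∀ x y : List Bool,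
      x.length = n₁ → y.length = n₂ →
      KC U (encRect (P.trans x y)) (encProt P) ≤ n₁ + n₂ + c := by
  obtain ⟨c, hc⟩ := exists_KC_le_of_mem hU
  refine ⟨c, fun n₁ n₂ P x y hx hy => hc _ _ _ _ ?_ ?_⟩
  · exact List.mem_flatMap.2 ⟨x, mem_allBV.2 hx, List.mem_map.2 ⟨y, mem_allBV.2 hy, rfl⟩⟩
  · simp [List.length_flatMap, length_allBV, pow_add]

/-- The bound on the information cost, with natural number logarithms. -/
theorem exists_ICost_le (hU : IsUniversal U) :
    ∃ K : ℕ, ∀ n₁ n₂ : ℕ, ∀ P : Protocol n₁ n₂, ∀ x y : List Bool,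
      x.length = n₁ → y.length = n₂ →
      ICost U P x y ≤ ((KC U (encRect (P.trans x y)) (encProt P)
        + Nat.log 2 (rectThick P (P.trans x y)) + K * Nat.size (max n₁ n₂) + K : ℕ) : ℝ) := by
  obtain ⟨c₁, h₁⟩ := exists_KC_le_KC_ePair hU
  obtain ⟨c₂, h₂⟩ := exists_KC_ePair_le_KC hU
  obtain ⟨c₃, h₃⟩ := exists_KC_trans_le hU
  obtain ⟨K, hK⟩ := exists_KC_encData_add_KC_encData_le hU c₃
  refine ⟨K + 1 + 2 * c₁ + 2 * c₂ + c₃, fun n₁ n₂ P x y hx hy => ?_⟩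
  have main : KC U (encRect (P.trans x y)) (ePair x (encProt P)) +
      KC U (encRect (P.trans x y)) (ePair y (encProt P)) ≤
      KC U (encRect (P.trans x y)) (encProt P) + Nat.log 2 (rectThick P (P.trans x y)) +
        K * Nat.size (max n₁ n₂) + (K + 1 + 2 * c₂ + c₃) := by
    have hk := h₃ n₁ n₂ P x y hx hy
    have hn₁ := le_max_left n₁ n₂
    have hn₂ := le_max_right n₁ n₂
    rcases le_or_gt (2 * max n₁ n₂) (Nat.log 2 (rectThick P (P.trans x y))) with hL | hL
    · have a₁ := h₂ (encRect (P.trans x y)) x (encProt P)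
      have a₂ := h₂ (encRect (P.trans x y)) y (encProt P)
      omega
    · have := hK ((P.trans x y).rows, (P.trans x y).cols)
        (P.rects.map fun R => (R.rows, R.cols))
        (eList ((allBV n₁).flatMap fun x => (allBV n₂).map fun y => encRect (P.trans x y)))
        x y (max n₁ n₂) (Nat.log 2 (rectThick P (P.trans x y)) + 1)
        (List.mem_map_of_mem (f := fun R : Rect => (R.rows, R.cols)) (P.trans_mem x y hx hy))
        (P.trans_row x y hx hy) (P.trans_col x y hx hy)
        (thickLE_of_rectThick_le P (Nat.lt_pow_succ_log_self one_lt_two _).le)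
        (hx.trans_le hn₁) (hy.trans_le hn₂) hL
      rw [← map_encRect_rects] at this
      change KC U (encRect (P.trans x y)) (encProt P) ≤ _ →
        KC U (encRect (P.trans x y)) (ePair x (encProt P)) +
          KC U (encRect (P.trans x y)) (ePair y (encProt P)) ≤
        KC U (encRect (P.trans x y)) (encProt P) + _ + _ + _ at this
      have := this (by omega)
      omega
  have b₁ := h₁ x (encRect (P.trans x y)) (ePair y (encProt P))
  have b₂ := h₁ y (encRect (P.trans x y)) (ePair x (encProt P))
  have hS : K * Nat.size (max n₁ n₂) ≤
      (K + 1 + 2 * c₁ + 2 * c₂ + c₃) * Nat.size (max n₁ n₂) :=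
    Nat.mul_le_mul_right _ (by omega)
  have total : KC U x (ePair y (encProt P)) +
        KC U (encRect (P.trans x y)) (ePair y (encProt P)) +
        (KC U y (ePair x (encProt P)) + KC U (encRect (P.trans x y)) (ePair x (encProt P))) ≤
      (KC U (encRect (P.trans x y)) (encProt P) + Nat.log 2 (rectThick P (P.trans x y)) +
        (K + 1 + 2 * c₁ + 2 * c₂ + c₃) * Nat.size (max n₁ n₂) +
        (K + 1 + 2 * c₁ + 2 * c₂ + c₃)) +
      (KC U (ePair x (encRect (P.trans x y))) (ePair y (encProt P)) +
        KC U (ePair y (encRect (P.trans x y))) (ePair x (encProt P))) := by omega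
  have total' := (Nat.cast_le (α := ℝ)).2 total
  rw [Nat.cast_add (_ + _ + _ + _ : ℕ)] at total'
  simp only [ICost, MI]
  push_cast at total' ⊢
  linarith

end InformationCost

/-- `IC_Π(x,y) ≤ C(t_{x,y} ∣ Π) + log₂ ρ(t_{x,y})` up to `O(log n)` precision. -/
theorem stmt14 (U : Machine) (hU : IsUniversal U) :
    ∃ d : ℝ, ∀ n₁ n₂ : ℕ, ∀ P : Protocol n₁ n₂, ∀ x y : List Bool,
      x.length = n₁ → y.length = n₂ →
      ICost U P x y ≤
        (KC U (encRect (P.trans x y)) (encProt P) : ℝ)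
          + Real.logb 2 (rectThick P (P.trans x y))
          + d * Real.logb 2 (max n₁ n₂) + d := by
  obtain ⟨K, hK⟩ := exists_ICost_le hU
  refine ⟨2 * K, fun n₁ n₂ P x y hx hy => ?_⟩
  have h := hK n₁ n₂ P x y hx hy
  have h₁ := natSize_le_logb_add_one (max n₁ n₂)
  have h₂ := Real.natLog_le_logb (rectThick P (P.trans x y)) 2
  have h₃ : 0 ≤ Real.logb 2 (max n₁ n₂ : ℕ) := by
    rcases Nat.eq_zero_or_pos (max n₁ n₂) with h0 | h0
    · simp [h0]
    · exact Real.logb_nonneg one_lt_two (by exact_mod_cast h0)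
  have h₄ := mul_le_mul_of_nonneg_left h₁ (Nat.cast_nonneg (α := ℝ) K)
  have h₅ := mul_nonneg (Nat.cast_nonneg (α := ℝ) K) h₃
  rw [← Nat.cast_max]
  rw [Nat.cast_add, Nat.cast_add, Nat.cast_add, Nat.cast_mul] at h
  rw [Nat.cast_ofNat] at h₂
  linarith
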